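/- arXiv:2006.10844 — 5 statements merged into one kernel-verified Lean document; each statement's English description precedes it below -/
import Mathlib

section
/- Let T be a commutative ring, let T' be a smooth T-algebra, let σ : T' → T be a T-algebra homomorphism, and let I = ker σ. Then for every n ≥ 1, the quotient I^{n-1}/I^n, regarded as a T-module via the isomorphism T'/I ≅ T induced by σ, is a finitely generated projective T-module. -/
namespace MvPolynomial

variable (ι R : Type*) [CommRing R]

theorem exists_linearEquiv_quotient_pow_idealOfVars [Finite ι] (n : ℕ) :
    Nonempty ((MvPolynomial ι R ⧸ idealOfVars ι R ^ n) ≃ₗ[R]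
      ({x : ι →₀ ℕ | x.degree < n} → R)) := by
  classical
  have hfin : Finite {x : ι →₀ ℕ | x.degree < n} := Finsupp.finite_of_degree_lt n
  have := Fintype.ofFinite {x : ι →₀ ℕ | x.degree < n}
  let c : MvPolynomial ι R →ₗ[R] ({x : ι →₀ ℕ | x.degree < n} → R) :=
    LinearMap.pi fun x ↦ lcoeff R x.1
  have hc : Function.Surjective c := fun v ↦ by
    refine ⟨∑ x, monomial x.1 (v x), ?_⟩
    ext y
    simp [c, coeff_monomial, Subtype.coe_inj]
  have hker : (idealOfVars ι R ^ n).restrictScalars R = LinearMap.ker c := by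
    ext p
    rw [Submodule.restrictScalars_mem, mem_pow_idealOfVars_iff', LinearMap.mem_ker]
    exact ⟨fun h ↦ _root_.funext fun x ↦ h x.1 x.2, fun h x hx ↦ congr_fun h ⟨x, hx⟩⟩
  exact ⟨(Submodule.Quotient.restrictScalarsEquiv R (idealOfVars ι R ^ n)).symm ≪≫ₗ
    Submodule.quotEquivOfEq _ _ hker ≪≫ₗ c.quotKerEquivOfSurjective hc⟩

theorem finite_quotient_pow_idealOfVars [Finite ι] (n : ℕ) :
    Module.Finite R (MvPolynomial ι R ⧸ idealOfVars ι R ^ n) := by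
  obtain ⟨e⟩ := exists_linearEquiv_quotient_pow_idealOfVars ι R n
  have : Finite {x : ι →₀ ℕ | x.degree < n} := Finsupp.finite_of_degree_lt n
  exact Module.Finite.equiv e.symm

theorem projective_quotient_pow_idealOfVars [Finite ι] (n : ℕ) :
    Module.Projective R (MvPolynomial ι R ⧸ idealOfVars ι R ^ n) := by
  obtain ⟨e⟩ := exists_linearEquiv_quotient_pow_idealOfVars ι R n
  have : Finite {x : ι →₀ ℕ | x.degree < n} := Finsupp.finite_of_degree_lt n
  exact Module.Projective.of_equiv e.symm

end MvPolynomial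

namespace Algebra

open MvPolynomial

variable {R A : Type*} [CommRing R] [CommRing A] [Algebra R A]

theorem FiniteType.exists_surjective_augmented [FiniteType R A] (σ : A →ₐ[R] R) :
    ∃ (m : ℕ) (f : MvPolynomial (Fin m) R →ₐ[R] A), Function.Surjective f ∧
      (RingHom.ker σ).comap f = idealOfVars (Fin m) R := by
  obtain ⟨m, g, hg⟩ := FiniteType.iff_quotient_mvPolynomial''.mp ‹FiniteType R A›
  let f : MvPolynomial (Fin m) R →ₐ[R] A :=
    aeval fun i ↦ g (X i) - algebraMap R A (σ (g (X i)))
  have hf : f.comp (aeval fun i ↦ X i + C (σ (g (X i)))) = g := by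
    ext i
    simp [f]
  have hσ (p) : σ (f p) = constantCoeff p := by
    have : σ.comp f = aeval fun _ ↦ 0 := by
      ext i
      simp [f]
    simpa using congr($this p)
  refine ⟨m, f, fun a ↦ ?_, ?_⟩
  · obtain ⟨p, rfl⟩ := hg a
    exact ⟨_, congr($hf p)⟩
  · ext p
    rw [Ideal.mem_comap, RingHom.mem_ker, hσ, ← pow_one (idealOfVars _ _),
      mem_pow_idealOfVars_iff']
    simp [constantCoeff_eq, Finsupp.degree_eq_zero_iff]

/-- By formal smoothness, the infinitesimal neighbourhood of a section of a smooth algebra is a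
retract of an infinitesimal neighbourhood of the origin in an affine space. -/
theorem Smooth.exists_retract_quotient_ker_pow [Smooth R A] (σ : A →ₐ[R] R) {n : ℕ}
    (hn : n ≠ 0) :
    ∃ (m : ℕ) (s : (A ⧸ RingHom.ker σ ^ n) →ₐ[R]
        (MvPolynomial (Fin m) R ⧸ idealOfVars (Fin m) R ^ n))
      (h : (MvPolynomial (Fin m) R ⧸ idealOfVars (Fin m) R ^ n) →ₐ[R]
        (A ⧸ RingHom.ker σ ^ n)), h.comp s = AlgHom.id R _ := by
  obtain ⟨m, f, hf, hker⟩ := FiniteType.exists_surjective_augmented σ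
  set I := RingHom.ker σ
  set J := idealOfVars (Fin m) R
  have hJI : J ^ n ≤ (I ^ n).comap f := by
    rw [← hker]
    exact Ideal.le_comap_pow f n
  let h : (MvPolynomial (Fin m) R ⧸ J ^ n) →ₐ[R] (A ⧸ I ^ n) := Ideal.quotientMapₐ _ f hJI
  have hh : Function.Surjective h := Ideal.quotientMap_surjective (H := hJI) hf
  have hmem (p : MvPolynomial (Fin m) R) (a : A) (ha : a ∈ I)
      (hp : h (Ideal.Quotient.mk _ p) = Ideal.Quotient.mk _ a) :
      Ideal.Quotient.mk (J ^ n) p ∈ J.map (Ideal.Quotient.mk (J ^ n)) := by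
    refine Ideal.mem_map_of_mem _ ?_
    have hsub : f p - a ∈ I ^ n := Ideal.Quotient.eq.mp hp
    rw [← hker, Ideal.mem_comap]
    simpa using add_mem (Ideal.pow_le_self hn hsub) ha
  have hnil : J.map (Ideal.Quotient.mk (J ^ n)) ^ n = ⊥ := by
    rw [← Ideal.map_pow, Ideal.map_quotient_self]
  have hkernil : IsNilpotent (RingHom.ker h.toRingHom) := by
    refine ⟨n, le_bot_iff.mp ((Ideal.pow_right_mono (fun x hx ↦ ?_) n).trans hnil.le)⟩
    obtain ⟨p, rfl⟩ := Ideal.Quotient.mk_surjective x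
    exact hmem p 0 (zero_mem _) (by simpa using hx)
  let g : A →ₐ[R] (MvPolynomial (Fin m) R ⧸ J ^ n) :=
    FormallySmooth.liftOfSurjective (Ideal.Quotient.mkₐ R (I ^ n)) h hh hkernil
  have hg (a : A) : h (g a) = Ideal.Quotient.mk _ a :=
    FormallySmooth.liftOfSurjective_apply (Ideal.Quotient.mkₐ R (I ^ n)) h hh hkernil a
  have hgI : I ≤ (J.map (Ideal.Quotient.mk (J ^ n))).comap g := fun a ha ↦ by
    obtain ⟨p, hp⟩ := Ideal.Quotient.mk_surjective (g a)
    rw [Ideal.mem_comap, ← hp]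
    exact hmem p a ha (hp ▸ hg a)
  have hgIn (a : A) (ha : a ∈ I ^ n) : g a = 0 := by
    have : a ∈ (J.map (Ideal.Quotient.mk (J ^ n)) ^ n).comap g :=
      Ideal.le_comap_pow g n (Ideal.pow_right_mono hgI n ha)
    simpa [hnil] using this
  refine ⟨m, Ideal.Quotient.liftₐ _ g hgIn, h, ?_⟩
  refine Ideal.Quotient.algHom_ext _ (AlgHom.ext fun a ↦ ?_)
  exact hg a

theorem Smooth.finite_quotient_ker_pow [Smooth R A] (σ : A →ₐ[R] R) (n : ℕ) :
    Module.Finite R (A ⧸ RingHom.ker σ ^ n) := by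
  rcases eq_or_ne n 0 with rfl | hn
  · have : Subsingleton (A ⧸ RingHom.ker σ ^ 0) := by
      rw [pow_zero, Ideal.one_eq_top]; exact Ideal.Quotient.subsingleton_iff.mpr rfl
    infer_instance
  obtain ⟨m, s, h, hs⟩ := Smooth.exists_retract_quotient_ker_pow σ hn
  have := finite_quotient_pow_idealOfVars (Fin m) R n
  exact Module.Finite.of_surjective h.toLinearMap fun x ↦ ⟨s x, congr($hs x)⟩

theorem Smooth.projective_quotient_ker_pow [Smooth R A] (σ : A →ₐ[R] R) (n : ℕ) :
    Module.Projective R (A ⧸ RingHom.ker σ ^ n) := by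
  rcases eq_or_ne n 0 with rfl | hn
  · have : Subsingleton (A ⧸ RingHom.ker σ ^ 0) := by
      rw [pow_zero, Ideal.one_eq_top]; exact Ideal.Quotient.subsingleton_iff.mpr rfl
    infer_instance
  obtain ⟨m, s, h, hs⟩ := Smooth.exists_retract_quotient_ker_pow σ hn
  have := projective_quotient_pow_idealOfVars (Fin m) R n
  exact Module.Projective.of_split s.toLinearMap h.toLinearMap
    (LinearMap.ext fun x ↦ congr($hs x))

end Algebra

/-- The kernel of a surjection onto a projective module is a direct summand. -/
theorem LinearMap.exists_retraction_of_ker_eq {R M N : Type*} [Ring R] [AddCommGroup M]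
    [Module R M] [AddCommGroup N] [Module R N] [Module.Projective R N] (f : M →ₗ[R] N)
    (hf : Function.Surjective f) {p : Submodule R M} (hp : LinearMap.ker f = p) :
    ∃ r : M →ₗ[R] p, r ∘ₗ p.subtype = LinearMap.id := by
  subst hp
  obtain ⟨s, hs⟩ := Module.projective_lifting_property f .id hf
  have hmem (x : M) : (.id - s ∘ₗ f : M →ₗ[R] M) x ∈ LinearMap.ker f := by
    simpa [sub_eq_zero] using congr($hs (f x)).symm
  refine ⟨(LinearMap.id - s ∘ₗ f).codRestrict _ hmem, ?_⟩
  ext x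
  simp

/-- For a smooth `T`-algebra `T'` with a `T`-algebra retraction `σ : T' → T`
with kernel `I`, the quotient `I^(n-1)/Iⁿ` (realized as the image of `I^(n-1)` in
`T'/Iⁿ`, with its `T`-module structure) is a finitely generated projective
`T`-module for every `n ≥ 1`. -/
theorem pow_quotient_pow_finite_projective {T T' : Type u} [CommRing T] [CommRing T']
    [Algebra T T'] [Algebra.Smooth T T'] (σ : T' →ₐ[T] T) (n : ℕ) (hn : 1 ≤ n) :
    Module.Finite T
      ↥(Ideal.map (Ideal.Quotient.mk (RingHom.ker σ ^ n)) (RingHom.ker σ ^ (n - 1))) ∧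
    Module.Projective T
      ↥(Ideal.map (Ideal.Quotient.mk (RingHom.ker σ ^ n)) (RingHom.ker σ ^ (n - 1))) := by
  have := Algebra.Smooth.finite_quotient_ker_pow σ n
  have := Algebra.Smooth.projective_quotient_ker_pow σ n
  have := Algebra.Smooth.projective_quotient_ker_pow σ (n - 1)
  let q : (T' ⧸ RingHom.ker σ ^ n) →ₐ[T] (T' ⧸ RingHom.ker σ ^ (n - 1)) :=
    Ideal.Quotient.factorₐ T (Ideal.pow_le_pow_right (Nat.sub_le n 1))
  have hq : Function.Surjective q :=
    Ideal.Quotient.factor_surjective (Ideal.pow_le_pow_right (Nat.sub_le n 1))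
  have hker : LinearMap.ker q.toLinearMap =
      (Ideal.map (Ideal.Quotient.mk (RingHom.ker σ ^ n))
        (RingHom.ker σ ^ (n - 1))).restrictScalars T := by
    ext x
    exact SetLike.ext_iff.mp
      (Ideal.Quotient.factor_ker (Ideal.pow_le_pow_right (Nat.sub_le n 1))) x
  obtain ⟨r, hr⟩ := q.toLinearMap.exists_retraction_of_ker_eq hq hker
  exact ⟨Module.Finite.of_surjective r fun x ↦ ⟨x, congr($hr x)⟩,
    Module.Projective.of_split _ r hr⟩
end

section
/- Let T be a commutative ring, let T' be a smooth T-algebra, let σ : T' → T be a T-algebra homomorphism, and let I = ker σ. Then for every n ≥ 1, the quotient ring T'/I^n is flat as a T-module. -/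
/-- The quotient of a polynomial ring by a power of the ideal of variables is free: the classes of
the monomials of small degree form a basis. -/
theorem MvPolynomial.free_quotient_idealOfVars_pow (ι R : Type*) [CommRing R] (n : ℕ) :
    Module.Free R (MvPolynomial ι R ⧸ MvPolynomial.idealOfVars ι R ^ n) := by
  let f : MvPolynomial ι R →ₗ[R] ({d : ι →₀ ℕ // d.degree < n} →₀ R) :=
    Finsupp.lcomapDomain Subtype.val Subtype.val_injective ∘ₗ
      (MvPolynomial.basisMonomials ι R).repr.toLinearMap
  have hf : Function.Surjective f :=
    (Finsupp.comapDomain_surjective Subtype.val_injective).comp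
      (MvPolynomial.basisMonomials ι R).repr.surjective
  have hker : (MvPolynomial.idealOfVars ι R ^ n).restrictScalars R = LinearMap.ker f := by
    ext p
    rw [Submodule.restrictScalars_mem, MvPolynomial.mem_pow_idealOfVars_iff', LinearMap.mem_ker,
      DFunLike.ext_iff, Subtype.forall]
    rfl
  exact .of_equiv (((Submodule.Quotient.restrictScalarsEquiv R _).symm ≪≫ₗ
    Submodule.quotEquivOfEq _ _ hker) ≪≫ₗ f.quotKerEquivOfSurjective hf).symm

/-- Let `π : P → A` be a surjection onto a formally smooth algebra and `I` an ideal of `A`. Then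
`P / π⁻¹(I)ⁿ → A / Iⁿ` has an algebra section. -/
theorem Algebra.FormallySmooth.exists_quotient_pow_section {R P A : Type*} [CommRing R]
    [CommRing P] [CommRing A] [Algebra R P] [Algebra R A] [Algebra.FormallySmooth R A]
    (π : P →ₐ[R] A) (hπ : Function.Surjective π) (I : Ideal A) {n : ℕ} (hn : n ≠ 0) :
    ∃ s : (A ⧸ I ^ n) →ₐ[R] P ⧸ I.comap π ^ n,
      (Ideal.quotientMapₐ (I ^ n) π (Ideal.le_comap_pow π n)).comp s = AlgHom.id R _ := by
  generalize hq : Ideal.quotientMapₐ (I ^ n) π (Ideal.le_comap_pow π n) = q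
  have hq_mk (p : P) : q (Ideal.Quotient.mk _ p) = Ideal.Quotient.mk _ (π p) := by
    rw [← hq]
    rfl
  have hq_surj : Function.Surjective q := fun x ↦ by
    obtain ⟨a, rfl⟩ := Ideal.Quotient.mk_surjective x
    obtain ⟨p, rfl⟩ := hπ a
    exact ⟨_, hq_mk p⟩
  let K : Ideal (P ⧸ I.comap π ^ n) := (I.comap π).map (Ideal.Quotient.mk _)
  have hK : K ^ n = ⊥ := by
    rw [← Ideal.map_pow, Ideal.map_quotient_self]
  have mem_K {x : P ⧸ I.comap π ^ n} {a : A} (ha : a ∈ I) (h : q x = Ideal.Quotient.mk _ a) :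
      x ∈ K := by
    obtain ⟨p, rfl⟩ := Ideal.Quotient.mk_surjective x
    rw [hq_mk, Ideal.Quotient.eq] at h
    exact Ideal.mem_map_of_mem _ ((Submodule.sub_mem_iff_left _ ha).mp (Ideal.pow_le_self hn h))
  have hq_nil : IsNilpotent (RingHom.ker q.toRingHom) :=
    ⟨n, le_bot_iff.mp ((Ideal.pow_right_mono
      (fun x (hx : q x = 0) ↦ mem_K I.zero_mem (by rw [hx, map_zero])) n).trans hK.le)⟩
  obtain ⟨s, hs⟩ : ∃ s : A →ₐ[R] P ⧸ I.comap π ^ n, ∀ a, q (s a) = Ideal.Quotient.mk _ a :=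
    ⟨liftOfSurjective (Ideal.Quotient.mkₐ R (I ^ n)) q hq_surj hq_nil,
      liftOfSurjective_apply _ q hq_surj hq_nil⟩
  have hsI : I ≤ K.comap s := fun a ha ↦ mem_K ha (hs a)
  have hsIn (a : A) (ha : a ∈ I ^ n) : s a = 0 := by
    have := Ideal.le_comap_pow s n (Ideal.pow_right_mono hsI n ha)
    rwa [Ideal.mem_comap, hK, Ideal.mem_bot] at this
  refine ⟨Ideal.Quotient.liftₐ (I ^ n) s hsIn, AlgHom.ext fun x ↦ ?_⟩
  obtain ⟨a, rfl⟩ := Ideal.Quotient.mk_surjective x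
  exact hs a

/-- The ideal of variables is the kernel of the constant coefficient. -/
theorem MvPolynomial.mem_idealOfVars_iff {ι R : Type*} [CommRing R] {p : MvPolynomial ι R} :
    p ∈ MvPolynomial.idealOfVars ι R ↔ MvPolynomial.constantCoeff p = 0 := by
  rw [← pow_one (MvPolynomial.idealOfVars ι R), MvPolynomial.mem_pow_idealOfVars_iff']
  simp [MvPolynomial.constantCoeff_eq, Finsupp.degree_eq_zero_iff]

/-- For a formally smooth augmented algebra, the quotients by the powers of the augmentation ideal
are projective. -/
theorem Algebra.FormallySmooth.projective_quotient_ker_pow {R A : Type*} [CommRing R] [CommRing A]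
    [Algebra R A] [Algebra.FormallySmooth R A] (σ : A →ₐ[R] R) (n : ℕ) :
    Module.Projective R (A ⧸ RingHom.ker σ ^ n) := by
  obtain rfl | hn := eq_or_ne n 0
  · have : Subsingleton (A ⧸ RingHom.ker σ ^ 0) :=
      Ideal.Quotient.subsingleton_iff.mpr (by simp)
    infer_instance
  let π : MvPolynomial (RingHom.ker σ) R →ₐ[R] A := MvPolynomial.aeval Subtype.val
  have hπ : Function.Surjective π := fun a ↦ by
    have ha : a - algebraMap R A (σ a) ∈ RingHom.ker σ := by simp
    exact ⟨MvPolynomial.C (σ a) + MvPolynomial.X ⟨_, ha⟩, by simp [π]⟩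
  have hσπ : σ.comp π = MvPolynomial.aeval 0 := by
    ext i
    simpa [π] using RingHom.mem_ker.mp i.2
  have hJ : (RingHom.ker σ).comap π = MvPolynomial.idealOfVars (RingHom.ker σ) R := by
    ext p
    rw [MvPolynomial.mem_idealOfVars_iff, Ideal.mem_comap, RingHom.mem_ker, ← AlgHom.comp_apply,
      hσπ, MvPolynomial.aeval_zero, Algebra.algebraMap_self_apply]
  obtain ⟨s, hs⟩ := exists_quotient_pow_section π hπ (RingHom.ker σ) hn
  have : Module.Projective R (MvPolynomial (RingHom.ker σ) R ⧸ (RingHom.ker σ).comap π ^ n) := by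
    have := MvPolynomial.free_quotient_idealOfVars_pow (RingHom.ker σ) R n
    rw [hJ]
    infer_instance
  exact .of_split s.toLinearMap (Ideal.quotientMapₐ _ π (Ideal.le_comap_pow π n)).toLinearMap
    (congrArg AlgHom.toLinearMap hs)

/-- For a smooth `T`-algebra `T'` with a `T`-algebra retraction `σ : T' → T`
with kernel `I`, the quotient `T'/Iⁿ` is flat as a `T`-module for every `n ≥ 1`. -/
theorem quotient_pow_flat {T T' : Type u} [CommRing T] [CommRing T'] [Algebra T T']
    [Algebra.Smooth T T'] (σ : T' →ₐ[T] T) (n : ℕ) (hn : 1 ≤ n) :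
    Module.Flat T (T' ⧸ (RingHom.ker σ ^ n)) := by
  have := Algebra.FormallySmooth.projective_quotient_ker_pow σ n
  infer_instance
end

section
/- Let T be a commutative ring, let T' be a smooth T-algebra, let σ : T' → T be a T-algebra homomorphism, and let I = ker σ. Then for every n ≥ 0, the ideal power I^n is flat as a T-module. -/
namespace MvPolynomial

/-- The quotient map `R[σ] → R[σ] ⧸ (X)ⁿ` has an `R`-linear section. -/
theorem exists_linearMap_section_quotient_pow_idealOfVars (σ R : Type*) [CommRing R] (n : ℕ) :
    ∃ s : (MvPolynomial σ R ⧸ idealOfVars σ R ^ n) →ₗ[R] MvPolynomial σ R,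
      ∀ q, Ideal.Quotient.mk _ (s q) = q := by
  classical
  let t : MvPolynomial σ R →ₗ[R] MvPolynomial σ R :=
    (basisMonomials σ R).constr R fun m ↦ if m.degree < n then monomial m 1 else 0
  have ht (m : σ →₀ ℕ) (r : R) : t (monomial m r) = if m.degree < n then monomial m r else 0 := by
    have h := (basisMonomials σ R).constr_basis R
      (fun m ↦ if m.degree < n then (monomial m 1 : MvPolynomial σ R) else 0) m
    rw [coe_basisMonomials] at h
    rw [← mul_one r, ← smul_eq_mul, ← smul_monomial, map_smul]
    change r • (Module.Basis.constr _ R _) _ = _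
    rw [h]
    split_ifs <;> simp
  have hker (p) (hp : p ∈ idealOfVars σ R ^ n) : t p = 0 := by
    rw [mem_pow_idealOfVars_iff] at hp
    rw [p.as_sum, map_sum]
    exact Finset.sum_eq_zero fun m hm ↦ by rw [ht, if_neg (hp m hm).not_gt]
  have hmk (p) : t p - p ∈ idealOfVars σ R ^ n := by
    induction p using MvPolynomial.induction_on' with
    | monomial m r =>
      rw [ht]
      split_ifs with h
      · simp
      · rw [zero_sub, neg_mem_iff, mem_pow_idealOfVars_iff']
        intro x hx
        rw [coeff_monomial, if_neg (by rintro rfl; exact h hx)]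
    | add p q hp hq =>
      rw [map_add, add_sub_add_comm]
      exact add_mem hp hq
  refine ⟨((idealOfVars σ R ^ n).restrictScalars R).liftQ t hker, fun q ↦ ?_⟩
  obtain ⟨p, rfl⟩ := Ideal.Quotient.mk_surjective q
  exact Ideal.Quotient.eq.mpr (hmk p)

end MvPolynomial

open MvPolynomial in
/-- Every power of the kernel of an augmentation of a formally smooth algebra is a direct summand. -/
theorem Algebra.FormallySmooth.exists_retraction_pow_ker {R A : Type*} [CommRing R] [CommRing A]
    [Algebra R A] [Algebra.FormallySmooth R A] (σ : A →ₐ[R] R) (n : ℕ) :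
    ∃ r : A →ₗ[R] ↥(RingHom.ker σ ^ n), ∀ x : ↥(RingHom.ker σ ^ n), r x = x := by
  rcases n.eq_zero_or_pos with rfl | hn
  · exact ⟨LinearMap.id.codRestrict ((RingHom.ker σ ^ 0).restrictScalars R) (by simp),
      fun _ ↦ rfl⟩
  set I := RingHom.ker σ
  let J := idealOfVars I R
  let f : MvPolynomial I R →ₐ[R] A := aeval (fun i : I ↦ (i : A))
  have hIσ (x : A) : x ∈ I ↔ σ x = 0 := RingHom.mem_ker
  have hf : Function.Surjective f := fun a ↦ by
    refine ⟨C (σ a) + X ⟨a - algebraMap R A (σ a), by simp [hIσ]⟩, ?_⟩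
    simp [f]
  have hfJ (p) (hp : f p ∈ I) : p ∈ J := by
    have h : σ.comp f = aeval (fun _ ↦ 0) := by
      ext i
      simpa [f] using (hIσ _).mp i.2
    have h0 : constantCoeff p = 0 := by
      have := congr($h p)
      rw [AlgHom.comp_apply, (hIσ _).mp hp] at this
      simpa [aeval_zero'] using this.symm
    rw [← pow_one J, mem_pow_idealOfVars_iff']
    intro x hx
    obtain rfl : x = 0 := (Finsupp.degree_eq_zero_iff x).mp (Nat.lt_one_iff.mp hx)
    simpa [constantCoeff_eq] using h0
  have hJI : J ≤ I.comap f := by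
    rw [Ideal.span_le]
    rintro _ ⟨i, rfl⟩
    simp [f]
  have hpow : J ^ n ≤ (I ^ n).comap f :=
    (Ideal.pow_right_mono hJI n).trans (Ideal.le_comap_pow f n)
  let g : (MvPolynomial I R ⧸ J ^ n) →ₐ[R] A ⧸ I ^ n := Ideal.quotientMapₐ (I ^ n) f hpow
  have hg (p) : g (Ideal.Quotient.mk _ p) = Ideal.Quotient.mk _ (f p) := rfl
  have hgs : Function.Surjective g := Ideal.quotientMap_surjective (H := hpow) hf
  let K := J.map (Ideal.Quotient.mk (J ^ n))
  have hK : K ^ n = ⊥ := by rw [← Ideal.map_pow, Ideal.map_quotient_self]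
  have hgK (x) (hx : x ∈ I) (q) (hq : g q = Ideal.Quotient.mk _ x) : q ∈ K := by
    obtain ⟨p, rfl⟩ := Ideal.Quotient.mk_surjective q
    rw [hg, Ideal.Quotient.eq] at hq
    refine Ideal.mem_map_of_mem _ (hfJ p ?_)
    simpa using add_mem (Ideal.pow_le_self hn.ne' hq) hx
  have hnil : IsNilpotent (RingHom.ker (g : _ →+* A ⧸ I ^ n)) :=
    ⟨n, le_bot_iff.mp <| (Ideal.pow_right_mono (fun q hq ↦
      hgK 0 (zero_mem _) q (by simpa using hq)) n).trans hK.le⟩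
  let l := Algebra.FormallySmooth.liftOfSurjective (Ideal.Quotient.mkₐ R (I ^ n)) g hgs hnil
  have hl (x) : g (l x) = Ideal.Quotient.mk _ x :=
    Algebra.FormallySmooth.liftOfSurjective_apply _ g hgs hnil x
  have hl0 (x) (hx : x ∈ I ^ n) : l x = 0 := by
    have : I ^ n ≤ (K ^ n).comap l :=
      (Ideal.pow_right_mono (fun y hy ↦ hgK y hy _ (hl y)) n).trans (Ideal.le_comap_pow l n)
    simpa [hK] using this hx
  obtain ⟨s, hs⟩ := exists_linearMap_section_quotient_pow_idealOfVars I R n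
  let e : A →ₗ[R] A := f.toLinearMap ∘ₗ s ∘ₗ l.toLinearMap
  have he (x) : x - e x ∈ I ^ n := by
    rw [← Ideal.Quotient.eq, ← hl x]
    exact congr(g $(hs (l x))).symm
  refine ⟨(LinearMap.id - e).codRestrict ((I ^ n).restrictScalars R) he, fun x ↦ ?_⟩
  refine Subtype.ext ?_
  change (x : A) - f (s (l x)) = x
  rw [hl0 x x.2, map_zero, map_zero, sub_zero]

/-- For a smooth `T`-algebra `T'` with a `T`-algebra retraction `σ : T' → T`
with kernel `I`, each ideal power `Iⁿ` (as a `T`-module by restriction of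
scalars along `T → T'`) is flat over `T`. -/
theorem pow_ker_flat {T T' : Type u} [CommRing T] [CommRing T'] [Algebra T T']
    [Algebra.Smooth T T'] (σ : T' →ₐ[T] T) (n : ℕ) :
    Module.Flat T ↥(RingHom.ker σ ^ n) := by
  obtain ⟨r, hr⟩ := Algebra.FormallySmooth.exists_retraction_pow_ker σ n
  exact .of_retract (((RingHom.ker σ ^ n).subtype).restrictScalars T) r (LinearMap.ext hr)
end

section
/- Let T be a commutative ring, let T' be a smooth T-algebra, let σ : T' → T be a T-algebra homomorphism, and let I = ker σ. Then the Rees algebra of I, namely the graded T'-subalgebra ⊕_{n≥0} I^n of the polynomial ring T'[X] whose degree-n piece consists of polynomials with i-th coefficient in I^i for all i > n (equivalently, Mathlib's reesAlgebra I), is flat as a T-module. -/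
section

open Polynomial

variable {T T' : Type*} [CommRing T] [CommRing T'] [Algebra T T']

/-- The powers of the ideal generated by the variables are complemented: truncation below total
degree `n` is a linear endomorphism killing this power, and the identity modulo it. -/
lemma MvPolynomial.exists_linearMap_pow_idealOfVars (ι R : Type*) [CommRing R] (n : ℕ) :
    ∃ s : MvPolynomial ι R →ₗ[R] MvPolynomial ι R,
      (∀ f ∈ idealOfVars ι R ^ n, s f = 0) ∧ ∀ f, f - s f ∈ idealOfVars ι R ^ n := by
  refine ⟨∑ i ∈ Finset.range n, homogeneousComponent i, fun f hf ↦ ?_, fun f ↦ ?_⟩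
  · rw [mem_pow_idealOfVars_iff'] at hf
    ext d
    simp only [LinearMap.sum_apply, coeff_sum, coeff_homogeneousComponent,
      Finset.sum_ite_eq, Finset.mem_range, coeff_zero]
    split_ifs with h
    · exact hf d h
    · rfl
  · rw [mem_pow_idealOfVars_iff']
    intro d hd
    simp [LinearMap.sum_apply, coeff_sum, coeff_homogeneousComponent, hd]

/-- The powers of the kernel of a retraction of a formally smooth algebra are complemented. -/
lemma Algebra.FormallySmooth.exists_projection_ker_pow [Algebra.FormallySmooth T T']
    (σ : T' →ₐ[T] T) (n : ℕ) :
    ∃ r : T' →ₗ[T] T', (∀ t, r t ∈ RingHom.ker σ ^ n) ∧ ∀ t ∈ RingHom.ker σ ^ n, r t = t := by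
  rcases eq_or_ne n 0 with rfl | hn
  · exact ⟨LinearMap.id, by simp, by simp⟩
  set I := RingHom.ker σ with hI
  set m := MvPolynomial.idealOfVars T' T with hm
  let π : MvPolynomial T' T →ₐ[T] T' :=
    MvPolynomial.aeval fun t ↦ t - algebraMap T T' (σ t)
  have hσπ : ∀ f, σ (π f) = MvPolynomial.constantCoeff f := by
    intro f
    have : σ.comp π = MvPolynomial.aeval (fun _ ↦ (0 : T)) := by
      ext t
      simp [π]
    simpa [MvPolynomial.aeval_zero'] using DFunLike.congr_fun this f
  have hmem : ∀ f, π f ∈ I → f ∈ m := by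
    intro f hf
    rw [hI, RingHom.mem_ker, hσπ] at hf
    rw [hm, ← pow_one (MvPolynomial.idealOfVars T' T), MvPolynomial.mem_pow_idealOfVars_iff']
    intro d hd
    obtain rfl : d = 0 := by simpa [Finsupp.degree_eq_zero_iff] using hd
    exact hf
  have hmI : m ≤ I.comap π := by
    rw [hm, MvPolynomial.idealOfVars, Ideal.span_le]
    rintro _ ⟨t, rfl⟩
    simp [hI, π]
  have hmIn : m ^ n ≤ (I ^ n).comap π :=
    (Ideal.pow_right_mono hmI n).trans (Ideal.le_comap_pow π n)
  let g : (MvPolynomial T' T ⧸ m ^ n) →ₐ[T] T' ⧸ I ^ n := Ideal.quotientMapₐ (I ^ n) π hmIn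
  have hg : Function.Surjective g := by
    intro x
    obtain ⟨t, rfl⟩ := Ideal.Quotient.mk_surjective x
    refine ⟨Ideal.Quotient.mk _ (MvPolynomial.X t + MvPolynomial.C (σ t)), ?_⟩
    simp [g, π]
  have hg_mk : ∀ f, g (Ideal.Quotient.mk _ f) = Ideal.Quotient.mk _ (π f) := fun f ↦ by simp [g]
  have hmn : (m.map (Ideal.Quotient.mk (m ^ n))) ^ n = ⊥ := by
    rw [← Ideal.map_pow, Ideal.map_quotient_self]
  have hker : IsNilpotent (RingHom.ker (g : (MvPolynomial T' T ⧸ m ^ n) →+* T' ⧸ I ^ n)) := by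
    refine ⟨n, le_bot_iff.mp (hmn ▸ Ideal.pow_right_mono ?_ n)⟩
    intro x hx
    obtain ⟨f, rfl⟩ := Ideal.Quotient.mk_surjective x
    refine Ideal.mem_map_of_mem _ (hmem f (Ideal.pow_le_self hn ?_))
    rw [← Ideal.Quotient.eq_zero_iff_mem, ← hg_mk]
    exact hx
  let h := Algebra.FormallySmooth.liftOfSurjective (Ideal.Quotient.mkₐ T (I ^ n)) g hg hker
  have hgh : ∀ t, g (h t) = Ideal.Quotient.mk _ t :=
    Algebra.FormallySmooth.liftOfSurjective_apply _ g hg hker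
  have hI_le : I ≤ (m.map (Ideal.Quotient.mk (m ^ n))).comap h := by
    intro t ht
    obtain ⟨f, hf⟩ := Ideal.Quotient.mk_surjective (h t)
    have hft : π f - t ∈ I ^ n := by
      rw [← Ideal.Quotient.eq, ← hg_mk, hf, hgh]
    rw [Ideal.mem_comap, ← hf]
    refine Ideal.mem_map_of_mem _ (hmem f ?_)
    simpa using add_mem (Ideal.pow_le_self hn hft) ht
  have hh : ∀ t ∈ I ^ n, h t = 0 := by
    intro t ht
    have := (Ideal.pow_right_mono hI_le n).trans (Ideal.le_comap_pow h n) ht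
    rwa [hmn] at this
  obtain ⟨s, hs, hs'⟩ := MvPolynomial.exists_linearMap_pow_idealOfVars T' T n
  let s' : (MvPolynomial T' T ⧸ m ^ n) →ₗ[T] MvPolynomial T' T :=
    Submodule.liftQ ((m ^ n).restrictScalars T) s hs
  have hs'_mk : ∀ x, Ideal.Quotient.mk (m ^ n) (s' x) = x := by
    intro x
    obtain ⟨f, rfl⟩ := Ideal.Quotient.mk_surjective x
    exact (Ideal.Quotient.eq.mpr (hs' f)).symm
  refine ⟨LinearMap.id - π.toLinearMap ∘ₗ s' ∘ₗ h.toLinearMap, fun t ↦ ?_, fun t ht ↦ ?_⟩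
  · change t - π (s' (h t)) ∈ I ^ n
    rw [← Ideal.Quotient.eq, ← hg_mk, hs'_mk, hgh]
  · change t - π (s' (h t)) = t
    simp [hh t ht]

/-- If all powers of an ideal of a flat algebra are complemented, its Rees algebra is flat. -/
lemma Module.Flat.reesAlgebra_of_projection [Module.Flat T T'] (I : Ideal T')
    (H : ∀ n, ∃ r : T' →ₗ[T] T', (∀ t, r t ∈ I ^ n) ∧ ∀ t ∈ I ^ n, r t = t) :
    Module.Flat T (reesAlgebra I) := by
  choose r hr hr' using H
  have : Module.Flat T T'[X] := Module.Flat.trans T T' T'[X]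
  let i : reesAlgebra I →ₗ[T] T'[X] := (reesAlgebra I).val.toLinearMap.restrictScalars T
  let p : T'[X] →ₗ[T] reesAlgebra I := Polynomial.lsum fun n ↦
    { toFun t := ⟨monomial n (r n t), reesAlgebra.monomial_mem.mpr (hr n t)⟩
      map_add' _ _ := by ext1; simp
      map_smul' c t := by
        ext1
        simp }
  refine Module.Flat.of_retract i p (LinearMap.ext fun f ↦ ?_)
  ext1
  change ((f : T'[X]).sum fun n t ↦
    (⟨monomial n (r n t), reesAlgebra.monomial_mem.mpr (hr n t)⟩ : reesAlgebra I) : reesAlgebra I).1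
    = f.1
  conv_rhs => rw [← f.1.sum_monomial_eq]
  simp only [Polynomial.sum_def, AddSubmonoidClass.coe_finsetSum]
  exact Finset.sum_congr rfl fun n _ ↦ by rw [hr' n _ (f.2 n)]

end

/-- For a smooth `T`-algebra `T'` with a `T`-algebra retraction `σ : T' → T`
with kernel `I`, the Rees algebra `⊕ₙ Iⁿ` of `I` (as a `T`-module by restriction
of scalars along `T → T'`) is flat over `T`. -/
theorem reesAlgebra_flat {T T' : Type u} [CommRing T] [CommRing T'] [Algebra T T']
    [Algebra.Smooth T T'] (σ : T' →ₐ[T] T) :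
    Module.Flat T ↥(reesAlgebra (RingHom.ker σ)) :=
  Module.Flat.reesAlgebra_of_projection _
    (Algebra.FormallySmooth.exists_projection_ker_pow σ)
end

section
/- Let T be a commutative ring, let T' be a smooth T-algebra, let σ : T' → T be a T-algebra homomorphism, and let I = ker σ. Let S be any commutative T-algebra, set S' = S ⊗_T T', let σ_S : S' → S be the base change of σ, and let I_S = ker σ_S. Then for every n ≥ 1, the canonical S-linear map I^n ⊗_T S → S' = S ⊗_T T' induced by the inclusion I^n ⊆ T' is injective, and its image is exactly the ideal power I_S^n; in particular I_S^n ≅ I^n ⊗_T S as S-modules. -/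
open TensorProduct

namespace MvPolynomial

variable {ι R : Type*} [CommRing R]

/-- The quotient of a polynomial ring by a power of the ideal of variables has an
`R`-linear section, given by truncation. -/
lemma exists_linear_section_mk_pow_idealOfVars (n : ℕ) :
    ∃ τ : (MvPolynomial ι R ⧸ idealOfVars ι R ^ n) →ₗ[R] MvPolynomial ι R,
      ∀ x, Ideal.Quotient.mk (idealOfVars ι R ^ n) (τ x) = x := by
  classical
  let t : MvPolynomial ι R →ₗ[R] MvPolynomial ι R :=
    (basisMonomials ι R).constr R fun m => if m.degree < n then monomial m 1 else 0
  have ht (p : MvPolynomial ι R) (d : ι →₀ ℕ) :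
      coeff d (t p) = if d.degree < n then coeff d p else 0 := by
    induction p using MvPolynomial.induction_on' with
    | monomial m a =>
      have : t (monomial m a) = a • if m.degree < n then monomial m 1 else 0 := by
        rw [← mul_one a, ← smul_eq_mul, ← smul_monomial, map_smul, smul_eq_mul, mul_one]
        exact congrArg (a • ·) ((basisMonomials ι R).constr_basis R _ m)
      rw [this]
      by_cases hmd : m = d
      · subst hmd
        split_ifs <;> simp
      · split_ifs <;> simp [coeff_monomial, hmd]
    | add p q hp hq =>
      rw [map_add, coeff_add, hp, hq, coeff_add]
      split_ifs <;> simp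
  let K : Submodule R (MvPolynomial ι R) := (idealOfVars ι R ^ n).restrictScalars R
  have hK : K ≤ LinearMap.ker t := fun p hp => by
    have hp' := (mem_pow_idealOfVars_iff' n p).mp hp
    rw [LinearMap.mem_ker]
    ext d
    rw [ht]
    split_ifs with h
    · simpa using hp' d h
    · simp
  refine ⟨K.liftQ t hK, fun x => ?_⟩
  obtain ⟨p, rfl⟩ := Ideal.Quotient.mk_surjective x
  refine Ideal.Quotient.eq.mpr ((mem_pow_idealOfVars_iff' n _).mpr fun d hd => ?_)
  change coeff d (t p - p) = 0
  rw [coeff_sub, ht, if_pos hd, sub_self]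

end MvPolynomial

namespace AlgHom

variable {R A : Type*} [CommRing R] [CommRing A] [Algebra R A]

/-- Let `p : P → A` be a surjection onto a formally smooth algebra, `I` an ideal of `A` and
`J` its preimage. Then `P ⧸ J ^ n → A ⧸ I ^ n` has a section induced by an algebra map from `A`. -/
lemma exists_lift_quotient_comap_pow {P : Type*} [CommRing P] [Algebra R P]
    [Algebra.FormallySmooth R A] (p : P →ₐ[R] A) (hp : Function.Surjective p) (I : Ideal A)
    {J : Ideal P} (hJ : J = I.comap p) {n : ℕ} (hn : n ≠ 0) :
    ∃ s : A →ₐ[R] P ⧸ J ^ n, (∀ x ∈ I ^ n, s x = 0) ∧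
      ∀ x q, Ideal.Quotient.mk (J ^ n) q = s x → p q - x ∈ I ^ n := by
  have hJI : J ^ n ≤ (I ^ n).comap p := by
    rw [hJ]
    exact Ideal.le_comap_pow p n
  obtain ⟨g, hgmk⟩ : ∃ g : (P ⧸ J ^ n) →ₐ[R] A ⧸ I ^ n,
      ∀ q, g (Ideal.Quotient.mk (J ^ n) q) = Ideal.Quotient.mk (I ^ n) (p q) :=
    ⟨Ideal.quotientMapₐ (I ^ n) p hJI, fun _ => rfl⟩
  have hg : Function.Surjective g := fun y => by
    obtain ⟨a, rfl⟩ := Ideal.Quotient.mk_surjective y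
    obtain ⟨q, rfl⟩ := hp a
    exact ⟨_, hgmk q⟩
  have hIn : I ^ n ≤ I := Ideal.pow_le_self hn
  have hmap : J.map (Ideal.Quotient.mk (J ^ n)) ^ n = ⊥ := by
    rw [← Ideal.map_pow, Ideal.map_quotient_self]
  have hker : RingHom.ker g ≤ J.map (Ideal.Quotient.mk (J ^ n)) := by
    intro x hx
    obtain ⟨q, rfl⟩ := Ideal.Quotient.mk_surjective x
    have hq : g (Ideal.Quotient.mk (J ^ n) q) = 0 := hx
    rw [hgmk, Ideal.Quotient.eq_zero_iff_mem] at hq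
    refine Ideal.mem_map_of_mem _ ?_
    rw [hJ]
    exact hIn hq
  have hnil : IsNilpotent (RingHom.ker g) :=
    ⟨n, eq_bot_mono (Ideal.pow_right_mono hker n) hmap⟩
  obtain ⟨s, hgs⟩ : ∃ s : A →ₐ[R] P ⧸ J ^ n, ∀ x, g (s x) = Ideal.Quotient.mk (I ^ n) x :=
    ⟨_, Algebra.FormallySmooth.liftOfSurjective_apply (Ideal.Quotient.mkₐ R (I ^ n)) g hg hnil⟩
  have hs (x : A) (q : P) (hq : Ideal.Quotient.mk (J ^ n) q = s x) : p q - x ∈ I ^ n := by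
    refine Ideal.Quotient.eq.mp ?_
    rw [← hgs x, ← hq, hgmk]
  have hsI : I ≤ (J.map (Ideal.Quotient.mk (J ^ n))).comap s := by
    intro x hx
    obtain ⟨q, hq⟩ := Ideal.Quotient.mk_surjective (s x)
    have hqI : p q ∈ I := by simpa using I.add_mem (hIn (hs x q hq)) hx
    rw [Ideal.mem_comap, ← hq]
    refine Ideal.mem_map_of_mem _ ?_
    rwa [hJ]
  refine ⟨s, fun x hx => ?_, hs⟩
  have hx' : s x ∈ J.map (Ideal.Quotient.mk (J ^ n)) ^ n :=
    Ideal.le_comap_pow s n (Ideal.pow_right_mono hsI n hx)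
  rwa [hmap] at hx'

open MvPolynomial in
/-- If `A` is formally smooth over `R` with an augmentation `σ : A →ₐ[R] R`, then every power of
the augmentation ideal is an `R`-linear direct summand of `A`. -/
lemma exists_retraction_pow_ker [Algebra.FormallySmooth R A] (σ : A →ₐ[R] R) {n : ℕ}
    (hn : n ≠ 0) :
    ∃ r : A →ₗ[R] ↥(RingHom.ker σ ^ n),
      r ∘ₗ (RingHom.ker σ ^ n).subtype.restrictScalars R = LinearMap.id := by
  let p : MvPolynomial A R →ₐ[R] A := aeval fun a => a - algebraMap R A (σ a)
  have hp : Function.Surjective p := fun a => ⟨X a + C (σ a), by simp [p]⟩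
  have hσp (q : MvPolynomial A R) : σ (p q) = constantCoeff q := by
    have : (σ.comp p : MvPolynomial A R →ₐ[R] R) = aeval 0 := by
      ext a
      simp [p]
    simpa using DFunLike.congr_fun this q
  have hJ : idealOfVars A R = (RingHom.ker σ).comap p := by
    ext q
    rw [Ideal.mem_comap, RingHom.mem_ker, hσp, ← pow_one (idealOfVars A R),
      mem_pow_idealOfVars_iff']
    simp [constantCoeff_eq, Finsupp.degree_eq_zero_iff]
  obtain ⟨s, hs₀, hs⟩ := exists_lift_quotient_comap_pow p hp _ hJ hn
  obtain ⟨τ, hτ⟩ := exists_linear_section_mk_pow_idealOfVars (ι := A) (R := R) n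
  let φ : A →ₗ[R] A := p.toLinearMap ∘ₗ τ ∘ₗ s.toLinearMap
  have hφ (x : A) : (LinearMap.id - φ : A →ₗ[R] A) x ∈ (RingHom.ker σ ^ n).restrictScalars R :=
    sub_mem_comm_iff.mp (hs x (τ (s x)) (hτ (s x)))
  refine ⟨(LinearMap.id - φ).codRestrict ((RingHom.ker σ ^ n).restrictScalars R) hφ, ?_⟩
  refine LinearMap.ext fun x => Subtype.ext ?_
  change (x : A) - p (τ (s x)) = x
  rw [hs₀ x x.2, map_zero, map_zero, sub_zero]

end AlgHom

open Algebra.TensorProduct in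
/-- The kernel of the base change of an augmentation is the extension of the kernel. -/
lemma Algebra.TensorProduct.ker_productMap_id_ofId {R A S : Type*} [CommRing R] [CommRing A]
    [CommRing S] [Algebra R A] [Algebra R S] (σ : A →ₐ[R] R) :
    RingHom.ker (productMap (AlgHom.id R S) ((Algebra.ofId R S).comp σ)) =
      (RingHom.ker σ).map (includeRight : A →ₐ[R] S ⊗[R] A) := by
  have hσ : Function.Surjective σ := fun r => ⟨algebraMap R A r, by simp⟩
  rw [← lTensor_ker _ hσ]
  have : productMap (AlgHom.id R S) ((Algebra.ofId R S).comp σ) =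
      (Algebra.TensorProduct.rid R R S).toAlgHom.comp (map (AlgHom.id R S) σ) := by
    refine Algebra.TensorProduct.ext' fun a b => ?_
    simp [Algebra.ofId_apply, Algebra.smul_def, mul_comm]
  rw [this]
  ext x
  simp [RingHom.mem_ker]

/-- Let `T'` be a smooth `T`-algebra with a `T`-algebra retraction `σ : T' → T`,
`I = ker σ`, and let `S` be a `T`-algebra. Let `σ_S : S' = S ⊗[T] T' → S` be the base
change of `σ` and `I_S = ker σ_S`. For every `n ≥ 1`, the canonical `T`-linear map
`Iⁿ ⊗[T] S → S ⊗[T] T'` (tensoring the inclusion `Iⁿ ⊆ T'` with `S`, followed by the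
symmetry of the tensor product) is injective, with image exactly `I_Sⁿ`;
in particular `I_Sⁿ ≅ Iⁿ ⊗[T] S`. -/
theorem pow_ker_baseChange {T T' S : Type u} [CommRing T] [CommRing T'] [CommRing S]
    [Algebra T T'] [Algebra T S] [Algebra.Smooth T T'] (σ : T' →ₐ[T] T) (n : ℕ)
    (hn : 1 ≤ n) :
    Function.Injective
      ((TensorProduct.comm T T' S).toLinearMap.comp
        (LinearMap.rTensor S (((RingHom.ker σ ^ n).subtype).restrictScalars T)) :
        ↥(RingHom.ker σ ^ n) ⊗[T] S →ₗ[T] S ⊗[T] T') ∧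
    LinearMap.range
      ((TensorProduct.comm T T' S).toLinearMap.comp
        (LinearMap.rTensor S (((RingHom.ker σ ^ n).subtype).restrictScalars T)) :
        ↥(RingHom.ker σ ^ n) ⊗[T] S →ₗ[T] S ⊗[T] T') =
    Submodule.restrictScalars T
      ((RingHom.ker
          (Algebra.TensorProduct.productMap (AlgHom.id T S)
            ((Algebra.ofId T S).comp σ))) ^ n) := by
  constructor
  · obtain ⟨r, hr⟩ := σ.exists_retraction_pow_ker (Nat.one_le_iff_ne_zero.mp hn)
    refine (TensorProduct.comm T T' S).injective.comp
      (Function.LeftInverse.injective (g := LinearMap.rTensor S r) fun x => ?_)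
    rw [← LinearMap.comp_apply, ← LinearMap.rTensor_comp, hr, LinearMap.rTensor_id,
      LinearMap.id_apply]
  · rw [Algebra.TensorProduct.ker_productMap_id_ofId, ← Ideal.map_pow, Ideal.map_includeRight_eq]
    refine Eq.trans ?_ (LinearMap.range_comp_of_range_eq_top
      (LinearMap.lTensor S ((RingHom.ker σ ^ n).restrictScalars T).subtype)
      (LinearEquiv.range (TensorProduct.comm T ↥(RingHom.ker σ ^ n) S)))
    exact congrArg LinearMap.range (TensorProduct.ext' fun _ _ => rfl)
end
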